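/- Let p be a positive integer, let G be a finite simple graph with minimum degree δ(G) ≥ 2p, and let S₀ ⊆ V(G) with |S₀| ≤ 2p − 1. Then for any connected component C of G − S₀, there exists a p-connected triple (S₁, S₂, F) of G such that V(F) ⊆ V(C). -/

import Mathlib

/-- In the graph `H` there exist `n` pairwise internally vertex-disjoint `u`–`v` paths:
`n` pairwise distinct paths from `u` to `v` such that any vertex lying on two of them
is an endpoint. -/
def InternallyDisjointPaths {W : Type*} (H : SimpleGraph W) (u v : W) (n : ℕ) : Prop :=
  ∃ P : Fin n → H.Walk u v,
    (∀ i, (P i).IsPath) ∧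
    (∀ i j, i ≠ j → P i ≠ P j) ∧
    (∀ i j, i ≠ j → ∀ x, x ∈ (P i).support → x ∈ (P j).support → x = u ∨ x = v)

/-- `(S₁, S₂, Fs)` is a `p`-connected triple of `G`: `Fs` is the vertex set of a
non-trivial connected component of `G - (S₁ ∪ S₂)`, such that
(i) `S₁ ∩ S₂ = ∅` and `|S₁ ∪ S₂| ≤ 2p - 1`;
(ii) every vertex of `S₁` has at most `p` neighbors in `Fs`;
(iii) every pair of distinct vertices of `S₂ ∪ Fs` is joined by at least `p + 1`
pairwise internally vertex-disjoint paths in `G[S₁ ∪ S₂ ∪ Fs]`. -/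
def PConnectedTriple {V : Type*} (G : SimpleGraph V) (p : ℕ)
    (S₁ S₂ Fs : Set V) : Prop :=
  Fs ⊆ (S₁ ∪ S₂)ᶜ ∧
  2 ≤ Fs.ncard ∧
  (G.induce Fs).Connected ∧
  (∀ x ∈ Fs, ∀ y, y ∉ S₁ ∪ S₂ → G.Adj x y → y ∈ Fs) ∧
  Disjoint S₁ S₂ ∧ (S₁ ∪ S₂).ncard ≤ 2 * p - 1 ∧
  (∀ v ∈ S₁, (G.neighborSet v ∩ Fs).ncard ≤ p) ∧
  (∀ u v : ↥(S₁ ∪ S₂ ∪ Fs), (u : V) ∈ S₂ ∪ Fs → (v : V) ∈ S₂ ∪ Fs → u ≠ v →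
    InternallyDisjointPaths (G.induce (S₁ ∪ S₂ ∪ Fs)) u v (p + 1))

namespace SimpleGraph

variable {V : Type*}

/-- `T` meets every walk of `G` from `A` to `B`. -/
def Separates (G : SimpleGraph V) (A B T : Set V) : Prop :=
  ∀ a ∈ A, ∀ b ∈ B, ∀ p : G.Walk a b, ∃ z ∈ p.support, z ∈ T

/-- There is a family, indexed by `ι`, of pairwise disjoint paths of `G` from `A` to `B`. -/
def Linked (G : SimpleGraph V) (A B : Set V) (ι : Type*) : Prop :=
  ∃ (a b : ι → V) (P : ∀ i, G.Walk (a i) (b i)), (∀ i, a i ∈ A) ∧ (∀ i, b i ∈ B) ∧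
    (∀ i, (P i).IsPath) ∧ ∀ i j z, z ∈ (P i).support → z ∈ (P j).support → i = j

/-- The vertices that can be reached from `A` in `G` avoiding `S`. -/
def reachAvoiding (G : SimpleGraph V) (A S : Set V) : Set V :=
  {z | ∃ a ∈ A, ∃ p : G.Walk a z, ∀ w ∈ p.support, w ∉ S}

theorem Separates.symm {G : SimpleGraph V} {A B T : Set V} (h : G.Separates A B T) :
    G.Separates B A T := fun b hb a ha p => by
  simpa using h a ha b hb p.reverse

theorem Linked.congr {G : SimpleGraph V} {A B : Set V} {ι κ : Type*} (e : κ ≃ ι)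
    (h : G.Linked A B ι) : G.Linked A B κ := by
  obtain ⟨a, b, P, ha, hb, hP, hd⟩ := h
  exact ⟨a ∘ e, b ∘ e, fun i => P (e i), fun i => ha _, fun i => hb _, fun i => hP _,
    fun i j z hi hj => e.injective (hd _ _ z hi hj)⟩

theorem Linked.mono {G G' : SimpleGraph V} (hG : G ≤ G') {A B : Set V} {ι : Type*}
    (h : G.Linked A B ι) : G'.Linked A B ι := by
  obtain ⟨a, b, P, ha, hb, hP, hd⟩ := h
  refine ⟨a, b, fun i => (P i).mapLe hG, ha, hb, fun i => ?_, fun i j z hi hj => ?_⟩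
  · exact (Walk.isPath_mapLe hG).2 (hP i)
  · rw [Walk.support_mapLe_eq_support] at hi hj
    exact hd i j z hi hj

/-- A linkage onto a set of matching size can be indexed by the endpoints. -/
theorem Linked.indexed_by_endpoint [Finite V] {G : SimpleGraph V} {A T : Set V} {k : ℕ}
    (h : G.Linked A T (Fin k)) (hT : T.ncard = k) :
    ∃ (a : T → V) (P : ∀ t : T, G.Walk (a t) t), (∀ t, a t ∈ A) ∧ (∀ t, (P t).IsPath) ∧
      ∀ s t z, z ∈ (P s).support → z ∈ (P t).support → s = t := by
  obtain ⟨a, b, P, ha, hb, hP, hd⟩ := h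
  have hinj : Function.Injective (fun i => (⟨b i, hb i⟩ : T)) := by
    intro i j hij
    have hij : b i = b j := congrArg Subtype.val hij
    refine hd i j (b i) (P i).end_mem_support ?_
    rw [hij]
    exact (P j).end_mem_support
  have hbij : Function.Bijective (fun i => (⟨b i, hb i⟩ : T)) := by
    refine hinj.bijective_of_nat_card_le ?_
    rw [Nat.card_coe_set_eq, hT, Nat.card_fin]
  let e := Equiv.ofBijective _ hbij
  have he : ∀ t, b (e.symm t) = t := fun t => congrArg Subtype.val (e.apply_symm_apply t)
  refine ⟨fun t => a (e.symm t), fun t => (P (e.symm t)).copy rfl (he t), fun t => ha _,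
    fun t => ?_, fun s t z hs ht => ?_⟩
  · simpa using hP _
  · rw [Walk.support_copy] at hs ht
    exact e.symm.injective (hd _ _ z hs ht)

theorem mem_reachAvoiding_of_mem {G : SimpleGraph V} {A S : Set V} {a : V} (ha : a ∈ A)
    (haS : a ∉ S) : a ∈ G.reachAvoiding A S :=
  ⟨a, ha, Walk.nil, by simpa using haS⟩

theorem notMem_of_mem_reachAvoiding {G : SimpleGraph V} {A S : Set V} {z : V}
    (hz : z ∈ G.reachAvoiding A S) : z ∉ S := by
  obtain ⟨a, -, p, hp⟩ := hz
  exact hp z p.end_mem_support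

theorem mem_reachAvoiding_of_adj {G : SimpleGraph V} {A S : Set V} {c d : V}
    (hc : c ∈ G.reachAvoiding A S) (hcd : G.Adj c d) (hd : d ∉ S) :
    d ∈ G.reachAvoiding A S := by
  obtain ⟨a, ha, p, hp⟩ := hc
  refine ⟨a, ha, p.concat hcd, fun w hw => ?_⟩
  rw [Walk.support_concat, List.mem_append, List.mem_singleton] at hw
  rcases hw with hw | rfl
  · exact hp w hw
  · exact hd

theorem Separates.disjoint_reachAvoiding {G : SimpleGraph V} {A B S : Set V}
    (h : G.Separates A B S) {z : V} (hA : z ∈ G.reachAvoiding A S) :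
    z ∉ G.reachAvoiding B S := by
  rintro ⟨b, hb, q, hq⟩
  obtain ⟨a, ha, p, hp⟩ := hA
  obtain ⟨w, hw, hwS⟩ := h a ha b hb (p.append q.reverse)
  rw [Walk.mem_support_append_iff, Walk.support_reverse, List.mem_reverse] at hw
  exact hw.elim (fun h => hp w h hwS) (fun h => hq w h hwS)

/-- A walk leaving a set has a step leaving it. -/
theorem Walk.exists_adj_leaving {G : SimpleGraph V} {R : Set V} {a b : V} (p : G.Walk a b)
    (ha : a ∈ R) (hb : b ∉ R) :
    ∃ x ∈ R, ∃ y ∈ p.support, y ∉ R ∧ G.Adj x y := by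
  induction p with
  | nil => exact absurd ha hb
  | @cons c d _ hcd q ih =>
    by_cases hd : d ∈ R
    · obtain ⟨x, hx, y, hy, hyR, hxy⟩ := ih hd hb
      exact ⟨x, hx, y, List.mem_cons_of_mem _ hy, hyR, hxy⟩
    · exact ⟨c, ha, d, List.mem_cons_of_mem _ q.start_mem_support, hd, hcd⟩

/-- A walk leaving `R := G'.reachAvoiding A S` contains a vertex of `insert x S` that can be
reached inside the walk in `G'`, if `G` arises from `G'` by adding an edge `xy` with `y ∉ R`. -/
theorem Walk.exists_walk_to_insert {G G' : SimpleGraph V} {A S : Set V} {x y : V}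
    (hG : ∀ c d, G.Adj c d → G'.Adj c d ∨ c = x ∨ c = y) (hy : y ∉ G'.reachAvoiding A S)
    {c b : V} (q : G.Walk c b) (hc : c ∈ G'.reachAvoiding A S)
    (hb : b ∉ G'.reachAvoiding A S) :
    ∃ z ∈ insert x S, ∃ r : G'.Walk c z, r.support ⊆ q.support := by
  induction q with
  | nil => exact absurd hc hb
  | @cons c d _ hcd q ih =>
    by_cases hcx : c = x
    · exact ⟨c, Or.inl hcx, Walk.nil, by simp⟩
    have hcd' : G'.Adj c d := by
      rcases hG c d hcd with h | h | h
      · exact h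
      · exact absurd h hcx
      · exact absurd (h ▸ hc) hy
    by_cases hd : d ∈ S
    · refine ⟨d, Or.inr hd, Walk.cons hcd' Walk.nil, ?_⟩
      simp
    · obtain ⟨z, hz, r, hr⟩ := ih (mem_reachAvoiding_of_adj hc hcd' hd) hb
      refine ⟨z, hz, Walk.cons hcd' r, ?_⟩
      rw [Walk.support_cons, Walk.support_cons]
      exact List.cons_subset_cons _ hr

theorem Separates.of_insert {G G' : SimpleGraph V} {A B S U : Set V} {x y : V}
    (hG : ∀ c d, G.Adj c d → G'.Adj c d ∨ c = x ∨ c = y) (hy : y ∉ G'.reachAvoiding A S)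
    (hS : G'.Separates A B S) (hU : G'.Separates A (insert x S) U) :
    G.Separates A B U := by
  intro a ha b hb q
  obtain ⟨z, hz, r, hr⟩ : ∃ z ∈ insert x S, ∃ r : G'.Walk a z, r.support ⊆ q.support := by
    by_cases haS : a ∈ S
    · exact ⟨a, Or.inr haS, Walk.nil, by simp⟩
    · refine q.exists_walk_to_insert hG hy (mem_reachAvoiding_of_mem ha haS) fun hbR => ?_
      exact hS.disjoint_reachAvoiding hbR
        (mem_reachAvoiding_of_mem hb (notMem_of_mem_reachAvoiding hbR))
  obtain ⟨w, hw, hwU⟩ := hU a ha z hz r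
  exact ⟨w, hr hw, hwU⟩

/-- Two linkages, from `A` and from `B`, onto supersets of a separator `S` only meet in `S`, and
only at their endpoints. -/
theorem Separates.eq_of_mem_support {G : SimpleGraph V} {A B S T T' : Set V}
    (hS : G.Separates A B S) (hT : S ⊆ T) (hT' : S ⊆ T')
    {a : T → V} {P : ∀ t : T, G.Walk (a t) t} (ha : ∀ t, a t ∈ A) (hP : ∀ t, (P t).IsPath)
    (hPd : ∀ s t z, z ∈ (P s).support → z ∈ (P t).support → s = t)
    {b : T' → V} {Q : ∀ t : T', G.Walk (b t) t} (hb : ∀ t, b t ∈ B) (hQ : ∀ t, (Q t).IsPath)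
    (hQd : ∀ s t z, z ∈ (Q s).support → z ∈ (Q t).support → s = t)
    {t : T} {t' : T'} {z : V} (hz : z ∈ (P t).support) (hz' : z ∈ (Q t').support) :
    z ∈ S ∧ (t : V) = z ∧ (t' : V) = z := by
  classical
  have keyP : ∀ w ∈ S, w ∈ (P t).support → (t : V) = w := fun w hw hwt =>
    congrArg Subtype.val (hPd t ⟨w, hT hw⟩ w hwt (P ⟨w, hT hw⟩).end_mem_support)
  have keyQ : ∀ w ∈ S, w ∈ (Q t').support → (t' : V) = w := fun w hw hwt =>
    congrArg Subtype.val (hQd t' ⟨w, hT' hw⟩ w hwt (Q ⟨w, hT' hw⟩).end_mem_support)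
  suffices hzS : z ∈ S from ⟨hzS, keyP z hzS hz, keyQ z hzS hz'⟩
  by_contra hzS
  obtain ⟨w, hw, hwS⟩ := hS _ (ha t) _ (hb t')
    (((P t).takeUntil z hz).append ((Q t').takeUntil z hz').reverse)
  rw [Walk.mem_support_append_iff, Walk.support_reverse, List.mem_reverse] at hw
  rcases hw with hw | hw
  · have h := keyP w hwS (Walk.support_takeUntil_subset_support _ _ hw)
    refine Walk.endpoint_notMem_support_takeUntil (hP t) hz ?_ (h ▸ hw)
    rintro rfl
    exact hzS (h ▸ hwS)
  · have h := keyQ w hwS (Walk.support_takeUntil_subset_support _ _ hw)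
    refine Walk.endpoint_notMem_support_takeUntil (hQ t') hz' ?_ (h ▸ hw)
    rintro rfl
    exact hzS (h ▸ hwS)

theorem Separates.linked_of_linked_insert [Finite V] {G G' : SimpleGraph V} (hle : G' ≤ G)
    {A B S : Set V} {x y : V} {k : ℕ} (hxy : G.Adj x y) (hx : x ∉ S) (hy : y ∉ S)
    (hk : S.ncard + 1 = k) (hS : G'.Separates A B S)
    (hA : G'.Linked A (insert x S) (Fin k)) (hB : G'.Linked B (insert y S) (Fin k)) :
    G.Linked A B (Fin k) := by
  classical
  have hcx : (insert x S).ncard = k := by rw [Set.ncard_insert_of_notMem hx, hk]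
  have hcy : (insert y S).ncard = k := by rw [Set.ncard_insert_of_notMem hy, hk]
  obtain ⟨a, P, ha, hP, hPd⟩ := hA.indexed_by_endpoint hcx
  obtain ⟨b, Q, hb, hQ, hQd⟩ := hB.indexed_by_endpoint hcy
  have cross := @Separates.eq_of_mem_support V G' A B S _ _ hS (Set.subset_insert x S)
    (Set.subset_insert y S) a P ha hP hPd b Q hb hQ hQd
  -- match `x` with `y` and every vertex of `S` with itself
  have step : ∀ t : ↥(insert x S), ∃ t' : ↥(insert y S),
      ((t : V) = x ∧ (t' : V) = y ∨ (t : V) ∈ S ∧ (t' : V) = t) ∧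
      ∃ r : G.Walk t t', ∀ w ∈ r.support, w = t ∨ w = t' := by
    rintro ⟨t, rfl | ht⟩
    · exact ⟨⟨y, Or.inl rfl⟩, Or.inl ⟨rfl, rfl⟩, Walk.cons hxy Walk.nil, by simp⟩
    · exact ⟨⟨t, Or.inr ht⟩, Or.inr ⟨ht, rfl⟩, Walk.nil, by simp⟩
  choose σ hσ r hr using step
  have hσinj : ∀ s t, σ s = σ t → s = t := by
    intro s t h
    have h' : (σ s : V) = σ t := congrArg Subtype.val h
    apply Subtype.ext
    rcases hσ s with ⟨h1, h2⟩ | ⟨h1, h2⟩ <;> rcases hσ t with ⟨h3, h4⟩ | ⟨h3, h4⟩ <;> grind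
  let R : ∀ t : ↥(insert x S), G.Walk (a t) (b (σ t)) := fun t =>
    (((P t).mapLe hle).append (r t)).append ((Q (σ t)).mapLe hle).reverse
  have hR : ∀ t, ∀ z ∈ (R t).bypass.support, z ∈ (P t).support ∨ z ∈ (Q (σ t)).support := by
    intro t z hz
    have hz := Walk.support_bypass_subset_support _ hz
    simp only [R, Walk.mem_support_append_iff, Walk.support_reverse, List.mem_reverse,
      Walk.support_mapLe_eq_support] at hz
    rcases hz with (hz | hz) | hz
    · exact Or.inl hz
    · rcases hr t z hz with rfl | rfl
      · exact Or.inl (P t).end_mem_support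
      · exact Or.inr (Q (σ t)).end_mem_support
    · exact Or.inr hz
  have hcross : ∀ s t z, z ∈ (P s).support → z ∈ (Q (σ t)).support → s = t := by
    intro s t z hs ht
    obtain ⟨hzS, h1, h2⟩ := cross hs ht
    apply Subtype.ext
    rcases hσ t with ⟨h3, h4⟩ | ⟨h3, h4⟩
    · exact absurd (h4 ▸ h2 ▸ hzS) hy
    · rw [h1, ← h2, h4]
  have hlink : G.Linked A B ↥(insert x S) := by
    refine ⟨a, fun t => b (σ t), fun t => (R t).bypass, ha, fun t => hb _,
      fun t => Walk.bypass_isPath _, fun s t z hs ht => ?_⟩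
    rcases hR s z hs with hs | hs <;> rcases hR t z ht with ht | ht
    · exact hPd s t z hs ht
    · exact hcross s t z hs ht
    · exact (hcross t s z ht hs).symm
    · exact hσinj _ _ (hQd _ _ z hs ht)
  refine hlink.congr (Finite.equivFinOfCardEq ?_).symm
  rw [Nat.card_coe_set_eq, hcx]

/-- **Menger's theorem** for two sets of vertices. -/
theorem linked_of_forall_separates [Finite V] (G : SimpleGraph V) (k : ℕ) :
    ∀ A B : Set V, (∀ T, G.Separates A B T → k ≤ T.ncard) → G.Linked A B (Fin k) := by
  induction G using WellFoundedLT.induction with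
  | ind G ih =>
  intro A B hsep
  by_cases hbot : G = ⊥
  · subst hbot
    have hk : k ≤ (A ∩ B).ncard := by
      refine hsep _ fun a ha b hb p => ?_
      cases p with
      | nil => exact ⟨a, by simp, ha, hb⟩
      | cons h _ => exact absurd h (by simp)
    obtain ⟨f⟩ : Nonempty (Fin k ↪ ↥(A ∩ B)) := by
      have : Fintype ↥(A ∩ B) := Fintype.ofFinite _
      refine Function.Embedding.nonempty_of_card_le ?_
      rwa [Fintype.card_fin, ← Nat.card_eq_fintype_card, Nat.card_coe_set_eq]
    refine ⟨fun i => f i, fun i => f i, fun i => Walk.nil, fun i => (f i).2.1,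
      fun i => (f i).2.2, fun i => Walk.IsPath.nil, fun i j z hi hj => ?_⟩
    simp only [Walk.support_nil, List.mem_singleton] at hi hj
    exact f.injective (Subtype.ext (hi.symm.trans hj))
  obtain ⟨x₀, y₀, h₀⟩ := ne_bot_iff_exists_adj.1 hbot
  have hle : G.deleteEdges {s(x₀, y₀)} ≤ G := deleteEdges_le _
  have hdel : ∀ c d, G.Adj c d → (G.deleteEdges {s(x₀, y₀)}).Adj c d ∨ s(c, d) = s(x₀, y₀) := by
    intro c d h
    rw [deleteEdges_adj]
    by_cases h' : s(c, d) = s(x₀, y₀)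
    · exact Or.inr h'
    · exact Or.inl ⟨h, h'⟩
  have hlt : G.deleteEdges {s(x₀, y₀)} < G := by
    refine lt_of_le_of_ne hle fun h => ?_
    rw [← h, deleteEdges_adj] at h₀
    exact h₀.2 rfl
  generalize G.deleteEdges {s(x₀, y₀)} = G' at hle hdel hlt
  by_cases hG' : ∀ T, G'.Separates A B T → k ≤ T.ncard
  · exact (ih G' hlt A B hG').mono hle
  push Not at hG'
  obtain ⟨S, hS, hSk⟩ := hG'
  -- the deleted edge `xy` leaves the part reachable from `A`
  obtain ⟨x, hx, y, hyS, hy, hxy⟩ : ∃ x ∈ G'.reachAvoiding A S, ∃ y, y ∉ S ∧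
      y ∉ G'.reachAvoiding A S ∧ G.Adj x y := by
    have hnot : ¬ G.Separates A B S := fun h => absurd (hsep S h) (by omega)
    unfold Separates at hnot
    push Not at hnot
    obtain ⟨a, ha, b, hb, p, hp⟩ := hnot
    obtain ⟨x, hx, y, hy, hyR, hxy⟩ := p.exists_adj_leaving
      (mem_reachAvoiding_of_mem (G := G') ha (hp a p.start_mem_support)) fun h =>
        hS.disjoint_reachAvoiding h (mem_reachAvoiding_of_mem hb (hp b p.end_mem_support))
    exact ⟨x, hx, y, hp y hy, hyR, hxy⟩
  have hxy₀ : s(x, y) = s(x₀, y₀) := by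
    refine (hdel x y hxy).resolve_left fun h => hy (mem_reachAvoiding_of_adj hx h hyS)
  have hG : ∀ c d, G.Adj c d → G'.Adj c d ∨ c = x ∨ c = y := by
    intro c d h
    refine (hdel c d h).imp_right fun h => ?_
    rw [← hxy₀, Sym2.eq_iff] at h
    tauto
  have hxS := notMem_of_mem_reachAvoiding hx
  have hA : ∀ U, G'.Separates A (insert x S) U → k ≤ U.ncard := fun U hU =>
    hsep U (Separates.of_insert hG hy hS hU)
  have hB : ∀ U, G'.Separates B (insert y S) U → k ≤ U.ncard := fun U hU =>
    hsep U (Separates.of_insert (fun c d h => (hG c d h).imp_right Or.symm)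
      (hS.disjoint_reachAvoiding hx) hS.symm hU).symm
  have hk : S.ncard + 1 = k := by
    have h := hA (insert x S) fun a _ b hb p => ⟨b, p.end_mem_support, hb⟩
    rw [Set.ncard_insert_of_notMem hxS] at h
    omega
  exact hS.linked_of_linked_insert hle hxy hxS hyS hk (ih G' hlt _ _ hA) (ih G' hlt _ _ hB)

/-- The graph obtained from `H` by removing all edges at `u` and `v`. -/
def isolatePair (H : SimpleGraph V) (u v : V) : SimpleGraph V where
  Adj a b := H.Adj a b ∧ (a ≠ u ∧ a ≠ v) ∧ b ≠ u ∧ b ≠ v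
  symm := ⟨fun _ _ h => ⟨h.1.symm, h.2.2, h.2.1⟩⟩
  loopless := ⟨fun _ h => h.1.ne rfl⟩

theorem isolatePair_le (H : SimpleGraph V) (u v : V) : H.isolatePair u v ≤ H :=
  fun _ _ h => h.1

theorem Walk.ne_of_mem_support_isolatePair {H : SimpleGraph V} {u v a b : V}
    (p : (H.isolatePair u v).Walk a b) (ha : a ≠ u ∧ a ≠ v) :
    ∀ w ∈ p.support, w ≠ u ∧ w ≠ v := by
  induction p with
  | nil => simpa using ha
  | cons h q ih =>
    intro w hw
    rw [Walk.support_cons, List.mem_cons] at hw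
    rcases hw with rfl | hw
    · exact ha
    · exact ih h.2.2 w hw

/-- Disjoint paths between the neighbourhoods of `u` and `v` extend to internally disjoint
`u`–`v` paths of length at least two. -/
theorem Linked.exists_paths {H : SimpleGraph V} {u v : V} (huv : u ≠ v) {k : ℕ}
    (h : (H.isolatePair u v).Linked (H.neighborSet u \ {v}) (H.neighborSet v \ {u}) (Fin k)) :
    ∃ P : Fin k → H.Walk u v, (∀ i, (P i).IsPath) ∧
      (∀ i, ∃ w ∈ (P i).support, w ≠ u ∧ w ≠ v) ∧
      ∀ i j, i ≠ j → ∀ x, x ∈ (P i).support → x ∈ (P j).support → x = u ∨ x = v := by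
  obtain ⟨a, b, P, ha, hb, hP, hd⟩ := h
  have hau : ∀ i, H.Adj u (a i) := fun i => (ha i).1
  have hbv : ∀ i, H.Adj (b i) v := fun i => (hb i).1.symm
  have hne : ∀ i, ∀ w ∈ (P i).support, w ≠ u ∧ w ≠ v := fun i =>
    (P i).ne_of_mem_support_isolatePair ⟨(hau i).ne', (ha i).2⟩
  have hle := H.isolatePair_le u v
  have hsupp : ∀ i w, w ∈ (Walk.cons (hau i) (((P i).mapLe hle).concat (hbv i))).support ↔
      w = u ∨ w ∈ (P i).support ∨ w = v := by
    intro i w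
    rw [Walk.support_cons, List.mem_cons, Walk.support_concat, List.mem_append,
      List.mem_singleton, Walk.support_mapLe_eq_support]
  refine ⟨fun i => Walk.cons (hau i) (((P i).mapLe hle).concat (hbv i)), fun i => ?_,
    fun i => ⟨a i, (hsupp i _).2 (Or.inr (Or.inl (P i).start_mem_support)),
      hne i _ (P i).start_mem_support⟩, fun i j hij x hi hj => ?_⟩
  · refine Walk.IsPath.cons (Walk.IsPath.concat ((Walk.isPath_mapLe hle).2 (hP i)) ?_ _) ?_
    · rw [Walk.support_mapLe_eq_support]
      exact fun h => (hne i v h).2 rfl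
    · rw [Walk.support_concat, List.mem_append, List.mem_singleton,
        Walk.support_mapLe_eq_support]
      rintro (h | h)
      · exact (hne i u h).1 rfl
      · exact huv h
  · rw [hsupp] at hi hj
    rcases hi with hi | hi | hi
    · exact Or.inl hi
    · rcases hj with hj | hj | hj
      · exact Or.inl hj
      · exact absurd (hd i j x hi hj) hij
      · exact Or.inr hj
    · exact Or.inr hi

theorem Linked.internallyDisjointPaths {H : SimpleGraph V} {u v : V} (huv : u ≠ v) {k : ℕ}
    (h : (H.isolatePair u v).Linked (H.neighborSet u \ {v}) (H.neighborSet v \ {u}) (Fin k)) :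
    InternallyDisjointPaths H u v k := by
  obtain ⟨P, hP, hint, hd⟩ := h.exists_paths huv
  refine ⟨P, hP, fun i j hij he => ?_, hd⟩
  obtain ⟨w, hw, hwu, hwv⟩ := hint i
  exact (hd i j hij w hw (he ▸ hw)).elim hwu hwv

theorem Linked.internallyDisjointPaths_succ {H : SimpleGraph V} {u v : V} (huv : H.Adj u v)
    {k : ℕ}
    (h : (H.isolatePair u v).Linked (H.neighborSet u \ {v}) (H.neighborSet v \ {u}) (Fin k)) :
    InternallyDisjointPaths H u v (k + 1) := by
  obtain ⟨P, hP, hint, hd⟩ := h.exists_paths huv.ne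
  have hedge : ∀ x ∈ huv.toWalk.support, x = u ∨ x = v := by simp
  have hne : ∀ i, P i ≠ huv.toWalk := by
    intro i he
    obtain ⟨w, hw, hwu, hwv⟩ := hint i
    exact (hedge w (he ▸ hw)).elim hwu hwv
  refine ⟨Fin.cons huv.toWalk P, fun i => ?_, fun i j => ?_, fun i j => ?_⟩
  · refine Fin.cases ?_ (fun i => ?_) i
    · exact Walk.IsPath.of_adj huv
    · exact hP i
  · refine Fin.cases ?_ (fun i => ?_) i <;> refine Fin.cases ?_ (fun j => ?_) j
    · exact fun h => absurd rfl h
    · exact fun _ => (hne j).symm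
    · exact fun _ => hne i
    · intro hij he
      change P i = P j at he
      obtain ⟨w, hw, hwu, hwv⟩ := hint i
      exact (hd i j (fun h => hij (h ▸ rfl)) w hw (he ▸ hw)).elim hwu hwv
  · refine Fin.cases ?_ (fun i => ?_) i <;> refine Fin.cases ?_ (fun j => ?_) j
    · exact fun h => absurd rfl h
    · exact fun _ x hx _ => hedge x hx
    · exact fun _ x _ hx => hedge x hx
    · exact fun hij => hd i j fun h => hij (h ▸ rfl)

open Classical in
/-- **Menger's theorem** for two vertices: failing `n + 1` internally disjoint `u`–`v` paths,
a set `T` separates `u` from `v` up to the edge `uv`. -/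
theorem exists_separation_of_not_internallyDisjointPaths [Finite V] {H : SimpleGraph V} {u v : V}
    (huv : u ≠ v) {n : ℕ} (h : ¬ InternallyDisjointPaths H u v (n + 1)) :
    ∃ A B T : Set V, u ∈ A ∧ v ∈ B ∧ Disjoint A B ∧ Disjoint A T ∧ Disjoint B T ∧
      A ∪ B ∪ T = Set.univ ∧ (∀ a ∈ A, ∀ b ∈ B, H.Adj a b → a = u ∧ b = v) ∧
      T.ncard + (if H.Adj u v then 1 else 0) ≤ n := by
  set ε := if H.Adj u v then 1 else 0 with hε
  have hnot : ¬ (H.isolatePair u v).Linked (H.neighborSet u \ {v}) (H.neighborSet v \ {u})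
      (Fin (n + 1 - ε)) := by
    intro hlink
    apply h
    by_cases hadj : H.Adj u v
    · have hεn : n + 1 - ε = n := by simp [hε, hadj]
      rw [hεn] at hlink
      exact hlink.internallyDisjointPaths_succ hadj
    · have hεn : n + 1 - ε = n + 1 := by simp [hε, hadj]
      rw [hεn] at hlink
      exact hlink.internallyDisjointPaths huv
  have hex : ∃ T, (H.isolatePair u v).Separates (H.neighborSet u \ {v}) (H.neighborSet v \ {u}) T ∧
      T.ncard < n + 1 - ε := by
    by_contra hcon
    push Not at hcon
    exact hnot (linked_of_forall_separates _ _ _ _ hcon)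
  obtain ⟨T, hT, hTn⟩ := hex
  set R := (H.isolatePair u v).reachAvoiding (H.neighborSet u \ {v}) T with hR
  have hRne : ∀ z ∈ R, z ≠ u ∧ z ≠ v := by
    rintro z ⟨a, ha, p, -⟩
    exact p.ne_of_mem_support_isolatePair ⟨(show H.Adj u a from ha.1).ne', ha.2⟩ z
      p.end_mem_support
  have hRT : ∀ z ∈ R, z ∉ T := fun z hz => notMem_of_mem_reachAvoiding hz
  have hRv : ∀ z ∈ R, ¬ H.Adj z v := fun z hz hzv =>
    hT.disjoint_reachAvoiding hz (mem_reachAvoiding_of_mem ⟨hzv.symm, (hRne z hz).1⟩ (hRT z hz))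
  refine ⟨insert u R, (insert u R ∪ (T \ {u, v}))ᶜ, T \ {u, v}, Or.inl rfl, ?_, ?_, ?_, ?_, ?_,
    ?_, ?_⟩
  · rintro ((h | h) | h)
    · exact huv h.symm
    · exact (hRne v h).2 rfl
    · exact h.2 (by simp)
  · exact Set.disjoint_left.2 fun z hz hz' => hz' (Or.inl hz)
  · rw [Set.disjoint_left]
    rintro z (rfl | hz) hzT
    · exact hzT.2 (by simp)
    · exact hRT z hz hzT.1
  · exact Set.disjoint_left.2 fun z hz hz' => hz (Or.inr hz')
  · ext z
    simp only [Set.mem_union, Set.mem_compl_iff, Set.mem_univ, iff_true]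
    tauto
  · intro a ha b hb hab
    simp only [Set.mem_compl_iff, Set.mem_union, Set.mem_insert_iff, Set.mem_sdiff,
      Set.mem_singleton_iff, not_or, not_and, not_not] at hb
    obtain ⟨⟨hbu, hbR⟩, hbT⟩ := hb
    by_cases hbv : b = v
    · refine ⟨?_, hbv⟩
      rcases ha with ha | ha
      · exact ha
      · exact absurd (hbv ▸ hab) (hRv a ha)
    exfalso
    have hbT' : b ∉ T := fun h => by
      have := hbT h
      tauto
    rcases ha with rfl | ha
    · exact hbR (mem_reachAvoiding_of_mem ⟨hab, hbv⟩ hbT')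
    · exact hbR (mem_reachAvoiding_of_adj ha ⟨hab, hRne a ha, hbu, hbv⟩ hbT')
  · have := Set.ncard_le_ncard (Set.sdiff_subset : T \ {u, v} ⊆ T) (Set.toFinite _)
    omega

/-- `F` is nonempty and a union of components of `G - S` for some `S` of size at most `m`. -/
def IsFragment (G : SimpleGraph V) (m : ℕ) (F : Set V) : Prop :=
  F.Nonempty ∧ ∃ S : Set V, S.ncard ≤ m ∧ Disjoint F S ∧ ∀ x ∈ F, ∀ y, y ∉ S → G.Adj x y → y ∈ F

theorem induce_connected_of_minimal {G : SimpleGraph V} {m : ℕ} {F : Set V}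
    (hF : G.IsFragment m F) (hmin : ∀ D ⊂ F, ¬ G.IsFragment m D) : (G.induce F).Connected := by
  obtain ⟨⟨x, hx⟩, S, hS, hFS, hcl⟩ := hF
  rw [connected_iff_exists_forall_reachable]
  refine ⟨⟨x, hx⟩, fun w => by_contra fun hw => ?_⟩
  refine hmin {y | ∃ h : y ∈ F, (G.induce F).Reachable ⟨x, hx⟩ ⟨y, h⟩} ⟨fun y hy => hy.1, ?_⟩
    ⟨⟨x, hx, Reachable.refl _⟩, S, hS, hFS.mono_left fun y hy => hy.1, ?_⟩
  · exact fun h => hw (h w.2).2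
  · rintro y ⟨hy, hxy⟩ z hz hyz
    have hzF := hcl y hy z hz hyz
    exact ⟨hzF, hxy.trans (Adj.reachable (G := G.induce F) (u := ⟨y, hy⟩) (v := ⟨z, hzF⟩) hyz)⟩

open Classical in
/-- In a minimal fragment `F` with boundary `S`, no side of a separation of `G[S ∪ F]` of order
at most `p` meets `S` in fewer than `p` vertices. -/
theorem le_ncard_inter_of_minimal [Finite V] {G : SimpleGraph V} {p : ℕ} (hp : 1 ≤ p)
    {F S A B T : Set V} (hcl : ∀ x ∈ F, ∀ y, y ∉ S → G.Adj x y → y ∈ F) (hFS : Disjoint F S)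
    (hmin : ∀ D ⊂ F, ¬ G.IsFragment (2 * p - 1) D) {u v : V} (hu : u ∈ A) (hv : v ∈ B)
    (huF : u ∉ F → p + 1 ≤ (G.neighborSet u ∩ F).ncard)
    (hvF : v ∉ F → p + 1 ≤ (G.neighborSet v ∩ F).ncard)
    (hAB : Disjoint A B) (hAT : Disjoint A T) (hcov : S ∪ F ⊆ A ∪ B ∪ T)
    (hadj : ∀ a ∈ A, ∀ b ∈ B, G.Adj a b → a = u ∧ b = v)
    (hT : T.ncard + (if G.Adj u v then 1 else 0) ≤ p) : p ≤ (S ∩ A).ncard := by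
  by_contra hlt
  set E : Set V := if G.Adj u v then {v} else ∅ with hE
  have hEn : T.ncard + E.ncard ≤ p := by
    rw [hE]
    split_ifs at hT ⊢ <;> simpa using hT
  have hvE : G.Adj u v → v ∈ E := fun h => by simp [hE, h]
  have hEv : ∀ w ∈ E, w = v := fun w hw => by
    rw [hE] at hw
    split_ifs at hw
    · exact hw
    · exact hw.elim
  refine hmin (A ∩ F) ⟨Set.inter_subset_right, fun hFA => ?_⟩
    ⟨?_, T ∪ E ∪ (S ∩ A), ?_, ?_, ?_⟩
  · -- `v` or one of its neighbours lies in `F` outside `A`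
    by_cases hvF' : v ∈ F
    · exact Set.disjoint_left.1 hAB (hFA hvF').1 hv
    · have h1 : G.neighborSet v ∩ F ⊆ {u} := fun w hw =>
        (hadj w (hFA hw.2).1 v hv (G.adj_symm hw.1)).1
      have h2 := Set.ncard_le_ncard h1 (Set.toFinite _)
      rw [Set.ncard_singleton] at h2
      have := hvF hvF'
      omega
  · by_cases huF' : u ∈ F
    · exact ⟨u, hu, huF'⟩
    · by_contra hempty
      have h1 : G.neighborSet u ∩ F ⊆ T ∪ E := by
        rintro w ⟨hw, hwF⟩
        rcases hcov (Or.inr hwF) with (hwA | hwB) | hwT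
        · exact absurd ⟨w, hwA, hwF⟩ hempty
        · obtain ⟨-, rfl⟩ := hadj u hu w hwB hw
          exact Or.inr (hvE hw)
        · exact Or.inl hwT
      have h2 := Set.ncard_le_ncard h1 (Set.toFinite _)
      have h3 := Set.ncard_union_le T E
      have := huF huF'
      omega
  · have h1 := Set.ncard_union_le (T ∪ E) (S ∩ A)
    have h2 := Set.ncard_union_le T E
    omega
  · rw [Set.disjoint_left]
    rintro w ⟨hwA, hwF⟩ ((hw | hw) | hw)
    · exact Set.disjoint_left.1 hAT hwA hw
    · exact Set.disjoint_left.1 hAB hwA (hEv w hw ▸ hv)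
    · exact Set.disjoint_left.1 hFS hwF hw.1
  · rintro x ⟨hxA, hxF⟩ y hy hxy
    have hySF : y ∈ S ∪ F := by
      by_cases hyS : y ∈ S
      · exact Or.inl hyS
      · exact Or.inr (hcl x hxF y hyS hxy)
    rcases hcov hySF with (hyA | hyB) | hyT
    · exact ⟨hyA, hySF.resolve_left fun hyS => hy (Or.inr ⟨hyS, hyA⟩)⟩
    · obtain ⟨rfl, rfl⟩ := hadj x hxA y hyB hxy
      exact absurd (Or.inl (Or.inr (hvE hxy))) hy
    · exact absurd (Or.inl (Or.inl hyT)) hy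

theorem internallyDisjointPaths_of_minimal [Finite V] {G : SimpleGraph V} {p : ℕ} (hp : 1 ≤ p)
    {F S : Set V} (hcl : ∀ x ∈ F, ∀ y, y ∉ S → G.Adj x y → y ∈ F) (hFS : Disjoint F S)
    (hS : S.ncard ≤ 2 * p - 1) (hmin : ∀ D ⊂ F, ¬ G.IsFragment (2 * p - 1) D)
    {W : Set V} (hW : W = S ∪ F) {u v : W} (huv : u ≠ v)
    (hu : (u : V) ∉ F → p + 1 ≤ (G.neighborSet u ∩ F).ncard)
    (hv : (v : V) ∉ F → p + 1 ≤ (G.neighborSet v ∩ F).ncard) :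
    InternallyDisjointPaths (G.induce W) u v (p + 1) := by
  classical
  by_contra hcon
  obtain ⟨A, B, T, huA, hvB, hAB, hAT, hBT, hcov, hadj, hT⟩ :=
    exists_separation_of_not_internallyDisjointPaths huv hcon
  let ι : W → V := Subtype.val
  have hι : Function.Injective ι := Subtype.val_injective
  have hcov' : S ∪ F ⊆ Set.image ι A ∪ Set.image ι B ∪ Set.image ι T := by
    rw [← Set.image_union, ← Set.image_union, hcov, Set.image_univ, Subtype.range_coe, hW]
  have hAB' : Disjoint (Set.image ι A) (Set.image ι B) := (Set.disjoint_image_iff hι).2 hAB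
  have hadj' : ∀ a ∈ Set.image ι A, ∀ b ∈ Set.image ι B, G.Adj a b → a = u ∧ b = v := by
    rintro _ ⟨a, ha, rfl⟩ _ ⟨b, hb, rfl⟩ hab
    obtain ⟨rfl, rfl⟩ := hadj a ha b hb hab
    exact ⟨rfl, rfl⟩
  have hT' : (Set.image ι T).ncard + (if G.Adj u v then 1 else 0) ≤ p := by
    rw [Set.ncard_image_of_injective _ hι]
    exact hT
  have h1 := le_ncard_inter_of_minimal hp hcl hFS hmin (Set.mem_image_of_mem ι huA)
    (Set.mem_image_of_mem ι hvB) hu hv hAB' ((Set.disjoint_image_iff hι).2 hAT) hcov' hadj' hT'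
  have h2 := le_ncard_inter_of_minimal hp hcl hFS hmin (Set.mem_image_of_mem ι hvB)
    (Set.mem_image_of_mem ι huA) hv hu hAB'.symm ((Set.disjoint_image_iff hι).2 hBT)
    (by rwa [Set.union_comm (Set.image ι B)]) (fun b hb a ha hba => (hadj' a ha b hb hba.symm).symm)
    (by rwa [G.adj_comm])
  have h3 : (S ∩ Set.image ι A ∪ S ∩ Set.image ι B).ncard =
      (S ∩ Set.image ι A).ncard + (S ∩ Set.image ι B).ncard :=
    Set.ncard_union_eq (hAB'.mono Set.inter_subset_right Set.inter_subset_right)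
  have h4 := Set.ncard_le_ncard (Set.union_subset Set.inter_subset_left Set.inter_subset_left :
    S ∩ Set.image ι A ∪ S ∩ Set.image ι B ⊆ S) (Set.toFinite _)
  omega

end SimpleGraph

theorem connected_triple_exists
    {V : Type} [Fintype V] (G : SimpleGraph V) [DecidableRel G.Adj]
    (p : ℕ) (hp : 1 ≤ p) (hdeg : 2 * p ≤ G.minDegree)
    (S₀ : Set V) (hS₀ : S₀.ncard ≤ 2 * p - 1)
    -- C is a connected component of G - S₀
    (C : Set V) (hCsub : C ⊆ S₀ᶜ) (hCne : C.Nonempty)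
    (hCconn : (G.induce C).Connected)
    (hCmax : ∀ x ∈ C, ∀ y, y ∉ S₀ → G.Adj x y → y ∈ C) :
    ∃ S₁ S₂ Fs : Set V, PConnectedTriple G p S₁ S₂ Fs ∧ Fs ⊆ C := by
  classical
  obtain ⟨F, hFmin⟩ := (Set.toFinite
    {F : Set V | F ⊆ C ∧ G.IsFragment (2 * p - 1) F}).exists_minimal
    ⟨C, subset_rfl, hCne, S₀, hS₀, Set.disjoint_left.2 fun x hx => hCsub hx, hCmax⟩
  obtain ⟨hFC, hF⟩ := hFmin.prop
  have hmin : ∀ D ⊂ F, ¬ G.IsFragment (2 * p - 1) D := fun D hD hDf =>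
    hD.2 (hFmin.le_of_le ⟨hD.1.trans hFC, hDf⟩ hD.1)
  have hconn := SimpleGraph.induce_connected_of_minimal hF hmin
  obtain ⟨⟨x, hx⟩, S, hS, hFS, hcl⟩ := hF
  have hSU : {v ∈ S | (G.neighborSet v ∩ F).ncard ≤ p} ∪
      {v ∈ S | ¬ (G.neighborSet v ∩ F).ncard ≤ p} = S := by
    ext v
    simp only [Set.mem_union, Set.mem_ofPred_eq]
    tauto
  refine ⟨{v ∈ S | (G.neighborSet v ∩ F).ncard ≤ p},
    {v ∈ S | ¬ (G.neighborSet v ∩ F).ncard ≤ p}, F, ⟨?_, ?_, hconn, ?_, ?_, ?_, ?_, ?_⟩, hFC⟩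
  · rw [hSU]
    exact fun y hy => Set.disjoint_left.1 hFS hy
  · obtain ⟨y, hxy, hyF⟩ : ∃ y, G.Adj x y ∧ y ∈ F := by
      by_contra! hno
      have h1 : G.neighborSet x ⊆ S := fun y hy =>
        by_contra fun hyS => hno y hy (hcl x hx y hyS hy)
      have h2 := Set.ncard_le_ncard h1 (Set.toFinite _)
      have h3 := G.minDegree_le_degree x
      rw [← Nat.card_coe_set_eq, Nat.card_eq_fintype_card, G.card_neighborSet_eq_degree] at h2
      omega
    exact (Set.one_lt_ncard (Set.toFinite _)).2 ⟨x, hx, y, hyF, hxy.ne⟩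
  · rw [hSU]
    exact hcl
  · exact Set.disjoint_left.2 fun v hv hv' => hv'.2 hv.2
  · rw [hSU]
    exact hS
  · exact fun v hv => hv.2
  · intro u v hu hv huv
    refine SimpleGraph.internallyDisjointPaths_of_minimal hp hcl hFS hS hmin (by rw [hSU]) huv
      (fun h => ?_) (fun h => ?_)
    · exact not_le.1 (hu.resolve_right h).2
    · exact not_le.1 (hv.resolve_right h).2
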